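/- arXiv:2401.17743 — 3 statements merged into one kernel-verified Lean document; each statement's English description precedes it below -/
import Mathlib

section
/- Under an information structure with binary state and two conditionally independent signals, for every ε ∈ (0,1), the probability that the two reports disagree extremely is small: P(|x1 − x2| ≥ 1 − ε) ≤ 2ε/(1−ε), where x1 = P(ω = 1 | s1) and x2 = P(ω = 1 | s2). -/
open Finset

/-- An information structure with a binary state `ω : Bool` (prior `μ = P(ω = 1)`) and two
signals `s1 : S1`, `s2 : S2` that are conditionally independent given the state,
encoded by the joint mass function `P`. -/
structure InfoStruct (S1 S2 : Type) [Fintype S1] [Fintype S2] : Type where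
  P : Bool → S1 → S2 → ℝ
  nonneg : ∀ ω s1 s2, 0 ≤ P ω s1 s2
  sum_one : ∑ ω : Bool, ∑ s1 : S1, ∑ s2 : S2, P ω s1 s2 = 1
  condIndep : ∀ ω s1 s2,
    (∑ t1 : S1, ∑ t2 : S2, P ω t1 t2) * P ω s1 s2 =
      (∑ t2 : S2, P ω s1 t2) * (∑ t1 : S1, P ω t1 s2)

namespace InfoStruct

variable {S1 S2 : Type} [Fintype S1] [Fintype S2]

/-- The prior `μ = P(ω = 1)`. -/
def prior (θ : InfoStruct S1 S2) : ℝ := ∑ s1 : S1, ∑ s2 : S2, θ.P true s1 s2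

/-- The marginal probability of a signal pair `(s1, s2)`. -/
def pSig (θ : InfoStruct S1 S2) (s1 : S1) (s2 : S2) : ℝ := ∑ ω : Bool, θ.P ω s1 s2

/-- The marginal probability of agent 1's signal. -/
def p1 (θ : InfoStruct S1 S2) (s1 : S1) : ℝ := ∑ ω : Bool, ∑ s2 : S2, θ.P ω s1 s2

/-- The marginal probability of agent 2's signal. -/
def p2 (θ : InfoStruct S1 S2) (s2 : S2) : ℝ := ∑ ω : Bool, ∑ s1 : S1, θ.P ω s1 s2

/-- Agent 1's report `x1 = P(ω = 1 | s1)`. -/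
noncomputable def x1 (θ : InfoStruct S1 S2) (s1 : S1) : ℝ :=
  (∑ s2 : S2, θ.P true s1 s2) / θ.p1 s1

/-- Agent 2's report `x2 = P(ω = 1 | s2)`. -/
noncomputable def x2 (θ : InfoStruct S1 S2) (s2 : S2) : ℝ :=
  (∑ s1 : S1, θ.P true s1 s2) / θ.p2 s2

/-- The posterior `P(ω = 1 | s1, s2)`. -/
noncomputable def post (θ : InfoStruct S1 S2) (s1 : S1) (s2 : S2) : ℝ :=
  θ.P true s1 s2 / θ.pSig s1 s2

/-- Expectation of a function of the report pair `(x1, x2)` under `θ`. -/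
noncomputable def expect (θ : InfoStruct S1 S2) (h : ℝ → ℝ → ℝ) : ℝ :=
  ∑ s1 : S1, ∑ s2 : S2, θ.pSig s1 s2 * h (θ.x1 s1) (θ.x2 s2)

/-- Probability that the report pair `(x1, x2)` lies in a set `A ⊆ ℝ²`. -/
noncomputable def probR (θ : InfoStruct S1 S2) (A : Set (ℝ × ℝ)) : ℝ :=
  ∑ s1 : S1, ∑ s2 : S2, A.indicator (fun _ => θ.pSig s1 s2) (θ.x1 s1, θ.x2 s2)

end InfoStruct

/-- The mass of the state that a report `x` declares unlikely, where `t` and `f` are the masses of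
the states `1` and `0`; it is `0` when `x` is not within `ε` of `0` or `1`. -/
noncomputable def surpriseMass (ε x t f : ℝ) : ℝ :=
  if 1 - ε ≤ x then f else if x ≤ ε then t else 0

lemma surpriseMass_nonneg (ε x : ℝ) {t f : ℝ} (ht : 0 ≤ t) (hf : 0 ≤ f) :
    0 ≤ surpriseMass ε x t f := by
  unfold surpriseMass
  split_ifs <;> simp [ht, hf]

/-- A calibrated report is surprised with mass at most an `ε` fraction of the total mass. -/
lemma sum_surpriseMass_le {T : Type*} [Fintype T] {ε : ℝ} (hε : 0 ≤ ε) (t f : T → ℝ)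
    (ht : ∀ j, 0 ≤ t j) (hf : ∀ j, 0 ≤ f j) :
    ∑ j, surpriseMass ε ((∑ k, t k) / (∑ k, t k + ∑ k, f k)) (t j) (f j) ≤
      ε * (∑ k, t k + ∑ k, f k) := by
  have hT : 0 ≤ ∑ k, t k := sum_nonneg fun j _ => ht j
  have hF : 0 ≤ ∑ k, f k := sum_nonneg fun j _ => hf j
  unfold surpriseMass
  rcases (add_nonneg hT hF).eq_or_lt with h | h
  · split_ifs <;> simp <;> nlinarith
  · split_ifs with h1 h2
    · rw [le_div_iff₀ h] at h1
      linarith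
    · rwa [div_le_iff₀ h] at h2
    · simpa using mul_nonneg hε h.le

/-- When two reports in `[0, 1]` disagree by at least `1 - ε`, one of them is surprised in each
state. -/
lemma ite_disagree_le_surpriseMass_add {ε x y t f : ℝ} (hε : ε < 1 / 2)
    (hx : x ∈ Set.Icc (0 : ℝ) 1) (hy : y ∈ Set.Icc (0 : ℝ) 1) (ht : 0 ≤ t) (hf : 0 ≤ f) :
    (if 1 - ε ≤ |x - y| then t + f else 0) ≤
      surpriseMass ε x t f + surpriseMass ε y t f := by
  obtain ⟨hx0, hx1⟩ := hx
  obtain ⟨hy0, hy1⟩ := hy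
  split_ifs with h
  · unfold surpriseMass
    rcases le_abs.mp h with h | h
    · rw [if_pos (by linarith), if_neg (by linarith), if_pos (by linarith)]
      linarith
    · rw [if_neg (by linarith), if_pos (by linarith), if_pos (by linarith)]
  · exact add_nonneg (surpriseMass_nonneg ε x ht hf) (surpriseMass_nonneg ε y ht hf)

lemma div_add_mem_Icc {a b : ℝ} (ha : 0 ≤ a) (hb : 0 ≤ b) : a / (a + b) ∈ Set.Icc (0 : ℝ) 1 :=
  ⟨by positivity, div_le_one_of_le₀ (by linarith) (by linarith)⟩

namespace InfoStruct

variable {S1 S2 : Type} [Fintype S1] [Fintype S2] (θ : InfoStruct S1 S2)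

lemma x1_eq (s1 : S1) : θ.x1 s1 =
    (∑ s2, θ.P true s1 s2) / (∑ s2, θ.P true s1 s2 + ∑ s2, θ.P false s1 s2) := by
  simp [x1, p1]

lemma x2_eq (s2 : S2) : θ.x2 s2 =
    (∑ s1, θ.P true s1 s2) / (∑ s1, θ.P true s1 s2 + ∑ s1, θ.P false s1 s2) := by
  simp [x2, p2]

lemma x1_mem_Icc (s1 : S1) : θ.x1 s1 ∈ Set.Icc (0 : ℝ) 1 := by
  rw [x1_eq]
  exact div_add_mem_Icc (sum_nonneg fun _ _ => θ.nonneg ..) (sum_nonneg fun _ _ => θ.nonneg ..)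

lemma x2_mem_Icc (s2 : S2) : θ.x2 s2 ∈ Set.Icc (0 : ℝ) 1 := by
  rw [x2_eq]
  exact div_add_mem_Icc (sum_nonneg fun _ _ => θ.nonneg ..) (sum_nonneg fun _ _ => θ.nonneg ..)

lemma sum_add_sum_eq_one :
    ∑ s1, ∑ s2, θ.P true s1 s2 + ∑ s1, ∑ s2, θ.P false s1 s2 = 1 := by
  simpa using θ.sum_one

lemma sum_surpriseMass_x1_le {ε : ℝ} (hε : 0 ≤ ε) :
    ∑ s1, ∑ s2, surpriseMass ε (θ.x1 s1) (θ.P true s1 s2) (θ.P false s1 s2) ≤ ε := by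
  calc _ ≤ ∑ s1, ε * (∑ s2, θ.P true s1 s2 + ∑ s2, θ.P false s1 s2) := by
        refine sum_le_sum fun s1 _ => ?_
        rw [x1_eq]
        exact sum_surpriseMass_le hε _ _ (θ.nonneg true s1) (θ.nonneg false s1)
    _ = ε := by rw [← mul_sum, sum_add_distrib, θ.sum_add_sum_eq_one, mul_one]

lemma sum_surpriseMass_x2_le {ε : ℝ} (hε : 0 ≤ ε) :
    ∑ s1, ∑ s2, surpriseMass ε (θ.x2 s2) (θ.P true s1 s2) (θ.P false s1 s2) ≤ ε := by
  rw [sum_comm]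
  calc _ ≤ ∑ s2, ε * (∑ s1, θ.P true s1 s2 + ∑ s1, θ.P false s1 s2) := by
        refine sum_le_sum fun s2 _ => ?_
        rw [x2_eq]
        exact sum_surpriseMass_le hε _ _ (fun _ => θ.nonneg ..) (fun _ => θ.nonneg ..)
    _ = ε := by
        rw [← mul_sum, sum_add_distrib, sum_comm, sum_comm (f := fun s2 s1 => θ.P false s1 s2),
          θ.sum_add_sum_eq_one, mul_one]

lemma pSig_eq (s1 : S1) (s2 : S2) : θ.pSig s1 s2 = θ.P true s1 s2 + θ.P false s1 s2 := by
  simp [pSig]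

lemma sum_ite_pSig_le_one (E : S1 → S2 → Prop) [∀ s1 s2, Decidable (E s1 s2)] :
    ∑ s1, ∑ s2, (if E s1 s2 then θ.pSig s1 s2 else 0) ≤ 1 := by
  rw [← θ.sum_add_sum_eq_one]
  simp only [← sum_add_distrib]
  refine sum_le_sum fun s1 _ => sum_le_sum fun s2 _ => ?_
  have h := add_nonneg (θ.nonneg true s1 s2) (θ.nonneg false s1 s2)
  rw [pSig_eq]
  split_ifs
  · exact le_rfl
  · exact h

end InfoStruct

/-- Extreme disagreement is unlikely: under a binary state and two
conditionally independent signals, for every `ε ∈ (0,1)`,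
`P(|x1 - x2| ≥ 1 - ε) ≤ 2ε/(1-ε)`. -/
theorem extreme_disagreement_unlikely {S1 S2 : Type} [Fintype S1] [Fintype S2]
    (θ : InfoStruct S1 S2) (ε : ℝ) (hε0 : 0 < ε) (hε1 : ε < 1) :
    (∑ s1 : S1, ∑ s2 : S2,
        if 1 - ε ≤ |θ.x1 s1 - θ.x2 s2| then θ.pSig s1 s2 else 0) ≤
      2 * ε / (1 - ε) := by
  have h2 : 2 * ε ≤ 2 * ε / (1 - ε) := le_div_self (by linarith) (by linarith) (by linarith)
  refine le_trans ?_ h2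
  rcases lt_or_ge ε (1 / 2) with h | h
  · calc _ ≤ ∑ s1, ∑ s2, (surpriseMass ε (θ.x1 s1) (θ.P true s1 s2) (θ.P false s1 s2) +
            surpriseMass ε (θ.x2 s2) (θ.P true s1 s2) (θ.P false s1 s2)) := by
          refine sum_le_sum fun s1 _ => sum_le_sum fun s2 _ => ?_
          rw [θ.pSig_eq]
          exact ite_disagree_le_surpriseMass_add h (θ.x1_mem_Icc s1) (θ.x2_mem_Icc s2)
            (θ.nonneg ..) (θ.nonneg ..)
      _ ≤ 2 * ε := by
          simp only [sum_add_distrib]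
          linarith [θ.sum_surpriseMass_x1_le hε0.le, θ.sum_surpriseMass_x2_le hε0.le]
  · exact (θ.sum_ite_pSig_le_one _).trans (by linarith)
end

section
/- For all N, M ∈ ℕ with M > N, the family Θ̄_{N,M} is a (6N/M, d_TV)-covering of Θ̄_N: for every information structure θ' ∈ Θ̄_N there exists θ ∈ Θ̄_{N,M} such that d_TV(P_θ, P_{θ'}) ≤ 6N/M. -/
open Finset

/-- Total variation distance between the report distributions of two information
structures: `d_TV(P,Q) = (1/2) ⨆_{‖h‖_∞ ≤ 1} (E_P[h] - E_Q[h])`. -/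
noncomputable def dTV {S1 S2 T1 T2 : Type} [Fintype S1] [Fintype S2] [Fintype T1] [Fintype T2]
    (θ : InfoStruct S1 S2) (θ' : InfoStruct T1 T2) : ℝ :=
  sSup {r : ℝ | ∃ h : ℝ → ℝ → ℝ, (∀ a b, |h a b| ≤ 1) ∧
    r = (θ.expect h - θ'.expect h) / 2}

/-- `r` lies in the discrete grid `[1/N] = {0, 1/N, 2/N, …, 1}`. -/
def inGrid (N : ℕ) (r : ℝ) : Prop := ∃ k : ℕ, k ≤ N ∧ r = (k : ℝ) / N

/-- Membership in `Θ̄_N`: all reports of the binary-signal information structure lie in the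
grid `[1/N]`. -/
def reportsInGrid (N : ℕ) (θ : InfoStruct Bool Bool) : Prop :=
  (∀ s1 : Bool, inGrid N (θ.x1 s1)) ∧ (∀ s2 : Bool, inGrid N (θ.x2 s2))

namespace InfoStruct

/-- The density of the joint law of two conditionally independent reports with prior `m`,
relative to the product of its marginals. -/
noncomputable def reportDensity (m x y : ℝ) : ℝ := x * y / m + (1 - x) * (1 - y) / (1 - m)

section

variable {S1 S2 : Type} [Fintype S1] [Fintype S2]

/-- The structure with signal marginals `p`, `r`, reports `a`, `b` and prior `m`. -/
noncomputable def ofReports (p a : S1 → ℝ) (r b : S2 → ℝ) (m : ℝ)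
    (hp : ∀ s, 0 ≤ p s) (ha0 : ∀ s, 0 ≤ a s) (ha1 : ∀ s, a s ≤ 1)
    (hr : ∀ s, 0 ≤ r s) (hb0 : ∀ s, 0 ≤ b s) (hb1 : ∀ s, b s ≤ 1)
    (hp1 : ∑ s, p s = 1) (hr1 : ∑ s, r s = 1)
    (hpa : ∑ s, p s * a s = m) (hrb : ∑ s, r s * b s = m)
    (hm0 : 0 ≤ m) (hm1 : m ≤ 1) : InfoStruct S1 S2 where
  P ω s t := match ω with
    | true => p s * a s * (r t * b t) / m
    | false => p s * (1 - a s) * (r t * (1 - b t)) / (1 - m)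
  nonneg ω s t := by
    have := sub_nonneg.2 (ha1 s)
    have := sub_nonneg.2 (hb1 t)
    have := sub_nonneg.2 hm1
    have := hp s
    have := hr t
    have := ha0 s
    have := hb0 t
    cases ω <;> simp only <;> positivity
  sum_one := by
    have hpa' : ∑ s, p s * (1 - a s) = 1 - m := by simp [mul_sub, hp1, hpa]
    have hrb' : ∑ s, r s * (1 - b s) = 1 - m := by simp [mul_sub, hr1, hrb]
    simp only [Fintype.sum_bool, ← Finset.sum_div, ← Finset.mul_sum, ← Finset.sum_mul,
      hpa, hrb, hpa', hrb', mul_self_div_self]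
    ring
  condIndep ω s t := by
    have hpa' : ∑ s, p s * (1 - a s) = 1 - m := by simp [mul_sub, hp1, hpa]
    have hrb' : ∑ s, r s * (1 - b s) = 1 - m := by simp [mul_sub, hr1, hrb]
    cases ω <;> simp only [← Finset.sum_div, ← Finset.mul_sum, ← Finset.sum_mul,
      hpa, hrb, hpa', hrb'] <;> ring

section

variable (p a : S1 → ℝ) (r b : S2 → ℝ) (m : ℝ)
    (hp : ∀ s, 0 ≤ p s) (ha0 : ∀ s, 0 ≤ a s) (ha1 : ∀ s, a s ≤ 1)
    (hr : ∀ s, 0 ≤ r s) (hb0 : ∀ s, 0 ≤ b s) (hb1 : ∀ s, b s ≤ 1)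
    (hp1 : ∑ s, p s = 1) (hr1 : ∑ s, r s = 1)
    (hpa : ∑ s, p s * a s = m) (hrb : ∑ s, r s * b s = m)
    (hm0 : 0 ≤ m) (hm1 : m ≤ 1)

theorem ofReports_prior :
    (ofReports p a r b m hp ha0 ha1 hr hb0 hb1 hp1 hr1 hpa hrb hm0 hm1).prior = m := by
  simp only [prior, ofReports, ← Finset.sum_div, ← Finset.mul_sum, ← Finset.sum_mul,
    hpa, hrb, mul_self_div_self]

theorem mul_div_self_of_sum_eq {S : Type} [Fintype S] {q : S → ℝ} {m : ℝ}
    (hq : ∀ s, 0 ≤ q s) (hm : ∑ s, q s = m) (s : S) : q s * m / m = q s := by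
  rcases eq_or_ne m 0 with h | h
  · have := (Finset.sum_eq_zero_iff_of_nonneg fun s _ => hq s).1 (hm.trans h) s (Finset.mem_univ s)
    simp [this]
  · field_simp

theorem ofReports_x1 (s : S1) :
    (ofReports p a r b m hp ha0 ha1 hr hb0 hb1 hp1 hr1 hpa hrb hm0 hm1).x1 s =
      p s * a s / p s := by
  have hpa' : ∑ s, p s * (1 - a s) = 1 - m := by simp [mul_sub, hp1, hpa]
  have hrb' : ∑ s, r s * (1 - b s) = 1 - m := by simp [mul_sub, hr1, hrb]
  simp only [x1, p1, ofReports, Fintype.sum_bool, ← Finset.sum_div, ← Finset.mul_sum,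
    hrb, hrb']
  rw [mul_div_self_of_sum_eq (fun s => mul_nonneg (hp s) (ha0 s)) hpa,
    mul_div_self_of_sum_eq (fun s => mul_nonneg (hp s) (sub_nonneg.2 (ha1 s))) hpa']
  congr 1
  ring

theorem ofReports_x2 (s : S2) :
    (ofReports p a r b m hp ha0 ha1 hr hb0 hb1 hp1 hr1 hpa hrb hm0 hm1).x2 s =
      r s * b s / r s := by
  have hpa' : ∑ s, p s * (1 - a s) = 1 - m := by simp [mul_sub, hp1, hpa]
  have hrb' : ∑ s, r s * (1 - b s) = 1 - m := by simp [mul_sub, hr1, hrb]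
  simp only [x2, p2, ofReports, Fintype.sum_bool, ← Finset.sum_div, ← Finset.sum_mul,
    hpa, hpa']
  rw [mul_comm m, mul_comm (1 - m),
    mul_div_self_of_sum_eq (fun s => mul_nonneg (hr s) (hb0 s)) hrb,
    mul_div_self_of_sum_eq (fun s => mul_nonneg (hr s) (sub_nonneg.2 (hb1 s))) hrb']
  congr 1
  ring

theorem ofReports_expect (h : ℝ → ℝ → ℝ) :
    (ofReports p a r b m hp ha0 ha1 hr hb0 hb1 hp1 hr1 hpa hrb hm0 hm1).expect h =
      ∑ s, ∑ t, p s * r t * (reportDensity m (a s) (b t) * h (a s) (b t)) := by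
  refine Finset.sum_congr rfl fun s _ => Finset.sum_congr rfl fun t _ => ?_
  rw [ofReports_x1, ofReports_x2]
  simp only [pSig, ofReports, Fintype.sum_bool, reportDensity]
  rcases eq_or_ne (p s) 0 with h1 | h1
  · simp [h1]
  rcases eq_or_ne (r t) 0 with h2 | h2
  · simp [h2]
  rw [mul_div_cancel_left₀ _ h1, mul_div_cancel_left₀ _ h2]
  ring

end

variable (θ : InfoStruct S1 S2)

theorem p1_nonneg (s : S1) : 0 ≤ θ.p1 s :=
  Finset.sum_nonneg fun _ _ => Finset.sum_nonneg fun _ _ => θ.nonneg _ _ _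

theorem p2_nonneg (s : S2) : 0 ≤ θ.p2 s :=
  Finset.sum_nonneg fun _ _ => Finset.sum_nonneg fun _ _ => θ.nonneg _ _ _

theorem sum_p1 : ∑ s, θ.p1 s = 1 := by
  rw [← θ.sum_one]
  exact Finset.sum_comm

theorem sum_p2 : ∑ s, θ.p2 s = 1 := by
  rw [← θ.sum_one]
  simp only [p2]
  rw [Finset.sum_comm]
  exact Finset.sum_congr rfl fun _ _ => Finset.sum_comm

theorem p1_mul_x1 (s : S1) : θ.p1 s * θ.x1 s = ∑ t, θ.P true s t := by
  refine mul_div_cancel_of_imp' fun h => ?_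
  exact (Finset.sum_eq_zero_iff_of_nonneg fun ω _ =>
    Finset.sum_nonneg fun t _ => θ.nonneg ω s t).1 h true (Finset.mem_univ _)

theorem p2_mul_x2 (t : S2) : θ.p2 t * θ.x2 t = ∑ s, θ.P true s t := by
  refine mul_div_cancel_of_imp' fun h => ?_
  exact (Finset.sum_eq_zero_iff_of_nonneg fun ω _ =>
    Finset.sum_nonneg fun s _ => θ.nonneg ω s t).1 h true (Finset.mem_univ _)

theorem p1_mul_one_sub_x1 (s : S1) : θ.p1 s * (1 - θ.x1 s) = ∑ t, θ.P false s t := by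
  rw [mul_sub, p1_mul_x1, p1, Fintype.sum_bool]
  ring

theorem p2_mul_one_sub_x2 (t : S2) : θ.p2 t * (1 - θ.x2 t) = ∑ s, θ.P false s t := by
  rw [mul_sub, p2_mul_x2, p2, Fintype.sum_bool]
  ring

theorem sum_p1_mul_x1 : ∑ s, θ.p1 s * θ.x1 s = θ.prior := by
  simp only [p1_mul_x1, prior]

theorem sum_p2_mul_x2 : ∑ s, θ.p2 s * θ.x2 s = θ.prior := by
  simp only [p2_mul_x2, prior]
  exact Finset.sum_comm

theorem one_sub_prior : 1 - θ.prior = ∑ s, ∑ t, θ.P false s t := by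
  rw [← θ.sum_one, Fintype.sum_bool, prior]
  ring

theorem prior_nonneg : 0 ≤ θ.prior :=
  Finset.sum_nonneg fun _ _ => Finset.sum_nonneg fun _ _ => θ.nonneg _ _ _

theorem prior_le_one : θ.prior ≤ 1 := by
  rw [← sub_nonneg, one_sub_prior]
  exact Finset.sum_nonneg fun _ _ => Finset.sum_nonneg fun _ _ => θ.nonneg _ _ _

theorem expect_eq (h0 : 0 < θ.prior) (h1 : θ.prior < 1) (h : ℝ → ℝ → ℝ) :
    θ.expect h = ∑ s, ∑ t, θ.p1 s * θ.p2 t *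
      (reportDensity θ.prior (θ.x1 s) (θ.x2 t) * h (θ.x1 s) (θ.x2 t)) := by
  refine Finset.sum_congr rfl fun s _ => Finset.sum_congr rfl fun t _ => ?_
  rw [← mul_assoc]
  congr 1
  have ht : θ.P true s t = θ.p1 s * θ.x1 s * (θ.p2 t * θ.x2 t) / θ.prior := by
    rw [eq_div_iff h0.ne', p1_mul_x1, p2_mul_x2, ← θ.condIndep, prior, mul_comm]
  have hf : θ.P false s t =
      θ.p1 s * (1 - θ.x1 s) * (θ.p2 t * (1 - θ.x2 t)) / (1 - θ.prior) := by
    rw [eq_div_iff (sub_pos.2 h1).ne', p1_mul_one_sub_x1, p2_mul_one_sub_x2, ← θ.condIndep,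
      one_sub_prior, mul_comm]
  rw [pSig, Fintype.sum_bool, ht, hf, reportDensity]
  ring

end

/-- The two masses on `a false` and `a true` having mean `m`. -/
noncomputable def splitWeight (a : Bool → ℝ) (m : ℝ) : Bool → ℝ
  | true => (m - a false) / (a true - a false)
  | false => (a true - m) / (a true - a false)

section

variable {a : Bool → ℝ} {m : ℝ}

theorem splitWeight_nonneg (h0 : a false ≤ m) (h1 : m ≤ a true) (s : Bool) :
    0 ≤ splitWeight a m s := by
  cases s <;> exact div_nonneg (by linarith) (by linarith)

theorem sum_splitWeight (h : a false < a true) : ∑ s, splitWeight a m s = 1 := by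
  have := (sub_pos.2 h).ne'
  simp only [Fintype.sum_bool, splitWeight]
  field_simp
  ring

theorem sum_splitWeight_mul (h : a false < a true) : ∑ s, splitWeight a m s * a s = m := by
  have := (sub_pos.2 h).ne'
  simp only [Fintype.sum_bool, splitWeight]
  field_simp
  ring

theorem abs_splitWeight_sub (h : a false < a true) (m' : ℝ) (s : Bool) :
    |splitWeight a m s - splitWeight a m' s| = |m - m'| / (a true - a false) := by
  have hd := sub_pos.2 h
  cases s <;> simp only [splitWeight, ← sub_div, abs_div, abs_of_pos hd]
  · rw [abs_sub_comm m m']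
    congr 2
    ring
  · congr 2
    ring

end

end InfoStruct

open InfoStruct

/-- Perturbation bound for the mass functions `q ⊗ r / m` as the marginals vary. -/
theorem sum_abs_mul_div_sub_le {S T : Type} [Fintype S] [Fintype T] {q q' : S → ℝ}
    {r r' : T → ℝ} {m m' : ℝ} (hq : ∀ s, 0 ≤ q s) (hr : ∀ t, 0 ≤ r t) (hq' : ∀ s, 0 ≤ q' s)
    (hqm : ∑ s, q s = m) (hrm : ∑ t, r t = m) (hqm' : ∑ s, q' s = m')
    (hm : 0 < m) (hm' : 0 ≤ m') :
    ∑ s, ∑ t, |q s * r t / m - q' s * r' t / m'| ≤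
      ∑ s, |q s - q' s| + ∑ t, |r t - r' t| + |m - m'| := by
  rcases hm'.eq_or_lt with rfl | hm'
  · have : ∑ s, ∑ t, |q s * r t / m - q' s * r' t / 0| = m := by
      have h (s t) : |q s * r t / m - q' s * r' t / 0| = q s * r t / m := by
        rw [div_zero, sub_zero, abs_of_nonneg]
        have := hq s
        have := hr t
        positivity
      simp only [h, ← Finset.sum_div, ← Finset.mul_sum, ← Finset.sum_mul, hqm, hrm,
        mul_self_div_self]
    rw [this, sub_zero, abs_of_pos hm]
    have : 0 ≤ ∑ s, |q s - q' s| := Finset.sum_nonneg fun _ _ => abs_nonneg _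
    have : 0 ≤ ∑ t, |r t - r' t| := Finset.sum_nonneg fun _ _ => abs_nonneg _
    linarith
  · have h (s t) : |q s * r t / m - q' s * r' t / m'| ≤
        |q s - q' s| * r t / m + q' s * |r t - r' t| / m' +
          q' s * r t * |m - m'| / (m * m') := by
      have e : q s * r t / m - q' s * r' t / m' =
          (q s - q' s) * (r t / m) + q' s / m' * (r t - r' t) +
            q' s * r t / (m * m') * (m' - m) := by
        field_simp
        ring
      have h1 : 0 ≤ r t / m := div_nonneg (hr t) hm.le
      have h2 : 0 ≤ q' s / m' := div_nonneg (hq' s) hm'.le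
      have h3 : 0 ≤ q' s * r t / (m * m') :=
        div_nonneg (mul_nonneg (hq' s) (hr t)) (by positivity)
      rw [e]
      refine (abs_add_three _ _ _).trans_eq ?_
      rw [abs_mul, abs_mul, abs_mul, abs_of_nonneg h1, abs_of_nonneg h2, abs_of_nonneg h3,
        abs_sub_comm m' m]
      ring
    refine (Finset.sum_le_sum fun s _ => Finset.sum_le_sum fun t _ => h s t).trans_eq ?_
    simp only [Finset.sum_add_distrib, ← Finset.sum_div, ← Finset.mul_sum, ← Finset.sum_mul,
      hqm', hrm]
    field_simp

/-- A mean-`m` law on at most two grid points is a mean-`m` law on two grid points `b false ≤ m`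
and `b true > m`. -/
theorem exists_splitWeight {N : ℕ} (hN : 1 ≤ N) {p a : Bool → ℝ} {m : ℝ} (hp : ∀ s, 0 ≤ p s)
    (hp1 : ∑ s, p s = 1) (hpa : ∑ s, p s * a s = m) (ha : ∀ s, inGrid N (a s)) (hm : m < 1) :
    ∃ b : Bool → ℝ, (∀ s, inGrid N (b s)) ∧ b false ≤ m ∧ m < b true ∧
      ∀ f : ℝ → ℝ, ∑ s, p s * f (a s) = ∑ s, splitWeight b m s * f (b s) := by
  have hN0 : (0 : ℝ) < N := by exact_mod_cast hN
  have key {x y u v : ℝ} (hu : 0 ≤ u) (hv : 0 ≤ v) (huv : u + v = 1) (hx : inGrid N x)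
      (hy : inGrid N y) (hxm : x ≤ m) (hxy : u * x + v * y = m) (hu0 : 0 < u) :
      ∃ b : Bool → ℝ, (∀ s, inGrid N (b s)) ∧ b false ≤ m ∧ m < b true ∧
        ∀ f : ℝ → ℝ, u * f x + v * f y = ∑ s, splitWeight b m s * f (b s) := by
    rcases lt_or_ge m y with hy' | hy'
    · refine ⟨fun s => cond s y x, by rintro (_ | _) <;> assumption, hxm, hy', fun f => ?_⟩
      have hd : y - x ≠ 0 := by linarith
      have e1 : (m - x) / (y - x) = v := by
        rw [div_eq_iff hd, ← hxy]
        linear_combination x * huv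
      have e2 : (y - m) / (y - x) = u := by
        rw [div_eq_iff hd, ← hxy]
        linear_combination -y * huv
      simp only [Fintype.sum_bool, splitWeight, cond_true, cond_false, e1, e2]
      ring
    · have hxm' : x = m := by
        refine le_antisymm hxm ?_
        by_contra! hlt
        nlinarith
      subst hxm'
      obtain ⟨k, hk, rfl⟩ := hx
      have hk' : k < N := by
        rw [div_lt_one hN0] at hm
        exact_mod_cast hm
      have hlt : (k : ℝ) / N < ((k + 1 : ℕ) : ℝ) / N := by
        gcongr
        exact Nat.lt_succ_self k
      refine ⟨fun s => cond s (((k + 1 : ℕ) : ℝ) / N) (k / N), ?_, le_rfl, hlt, fun f => ?_⟩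
      · rintro (_ | _)
        · exact ⟨k, hk, rfl⟩
        · exact ⟨k + 1, hk', rfl⟩
      have hv' : v * f y = v * f (k / N) := by
        have : v * (y - k / N) = 0 := by linear_combination hxy - (k / N : ℝ) * huv
        rcases mul_eq_zero.1 this with h | h
        · simp [h]
        · rw [sub_eq_zero.1 h]
      simp only [Fintype.sum_bool, splitWeight, cond_true, cond_false, sub_self, zero_div,
        zero_mul, zero_add, div_self (sub_pos.2 hlt).ne', hv']
      rw [← add_mul, huv]
  rw [Fintype.sum_bool] at hp1 hpa
  have hcase : (a true ≤ m ∧ 0 < p true) ∨ (a false ≤ m ∧ 0 < p false) := by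
    by_contra! hc
    rcases (hp true).eq_or_lt with h | h
    · have := hc.2
      have hf : p false = 1 := by linarith
      have : a false = m := by rw [← hpa, ← h, hf]; ring
      linarith [hc.2 this.le]
    · rcases (hp false).eq_or_lt with h' | h'
      · have hf : p true = 1 := by linarith
        have : a true = m := by rw [← hpa, ← h', hf]; ring
        linarith [hc.1 this.le]
      · have h1 : m < a true := by
          by_contra! hle
          linarith [hc.1 hle]
        have h2 : m < a false := by
          by_contra! hle
          linarith [hc.2 hle]
        nlinarith
  simp only [Fintype.sum_bool (fun s => p s * _)]
  rcases hcase with ⟨h1, h2⟩ | ⟨h1, h2⟩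
  · exact key (hp _) (hp _) hp1 (ha _) (ha _) h1 hpa h2
  · simp only [add_comm (p true * _)]
    exact key (hp _) (hp _) (by linarith) (ha _) (ha _) h1 (by linarith) h2

theorem inGrid.nonneg {N : ℕ} {r : ℝ} (h : inGrid N r) : 0 ≤ r := by
  obtain ⟨k, -, rfl⟩ := h
  positivity

theorem inGrid.le_one {N : ℕ} {r : ℝ} (h : inGrid N r) : r ≤ 1 := by
  obtain ⟨k, hk, rfl⟩ := h
  exact div_le_one_of_le₀ (by exact_mod_cast hk) (by positivity)

theorem inGrid.one_le_mul_sub {N : ℕ} (hN : 1 ≤ N) {x y : ℝ} (hx : inGrid N x)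
    (hy : inGrid N y) (hxy : x < y) : 1 ≤ N * (y - x) := by
  have hN0 : (0 : ℝ) < N := by exact_mod_cast hN
  obtain ⟨k, -, rfl⟩ := hx
  obtain ⟨l, -, rfl⟩ := hy
  have : k + 1 ≤ l := by
    rw [div_lt_div_iff_of_pos_right hN0] at hxy
    exact_mod_cast hxy
  have : (k : ℝ) + 1 ≤ l := by exact_mod_cast this
  rw [mul_sub, mul_div_cancel₀ _ hN0.ne', mul_div_cancel₀ _ hN0.ne']
  linarith

/-- An interval of length at least `1 / M` contains a grid point near each of its points. -/
theorem exists_inGrid_near {M : ℕ} (hM : 0 < M) {L U m : ℝ} (hL0 : 0 ≤ L) (hU1 : U ≤ 1)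
    (hLm : L ≤ m) (hmU : m ≤ U) (hLU : 1 ≤ M * (U - L)) :
    ∃ m', inGrid M m' ∧ L ≤ m' ∧ m' ≤ U ∧ |m - m'| ≤ 1 / M := by
  have hM0 : (0 : ℝ) < M := by exact_mod_cast hM
  have hm0 : 0 ≤ M * m := by nlinarith
  have hf := Nat.floor_le hm0
  have hf' := Nat.lt_floor_add_one (M * m)
  have mk (k : ℕ) (h1 : M * L ≤ k) (h2 : k ≤ M * U) (h3 : |M * m - k| ≤ 1) :
      ∃ m', inGrid M m' ∧ L ≤ m' ∧ m' ≤ U ∧ |m - m'| ≤ 1 / M := by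
    refine ⟨k / M, ⟨k, ?_, rfl⟩, ?_, ?_, ?_⟩
    · have : (k : ℝ) ≤ M := by nlinarith
      exact_mod_cast this
    · rw [le_div_iff₀ hM0]
      linarith
    · rw [div_le_iff₀ hM0]
      linarith
    · rw [le_div_iff₀ hM0, ← abs_of_pos hM0, ← abs_mul, abs_of_pos hM0, sub_mul,
        div_mul_cancel₀ _ hM0.ne', mul_comm m]
      exact h3
  rcases le_or_gt (M * L) ⌊(M * m : ℝ)⌋₊ with h | h
  · exact mk _ h (by nlinarith) (by rw [abs_le]; constructor <;> linarith)
  · refine mk (⌊(M * m : ℝ)⌋₊ + 1) ?_ ?_ ?_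
    · push_cast
      nlinarith
    · push_cast
      linarith
    · push_cast
      rw [abs_le]
      constructor <;> linarith

theorem dTV_le {S1 S2 T1 T2 : Type} [Fintype S1] [Fintype S2] [Fintype T1] [Fintype T2]
    {θ : InfoStruct S1 S2} {θ' : InfoStruct T1 T2} {c : ℝ}
    (hc : ∀ h : ℝ → ℝ → ℝ, (∀ a b, |h a b| ≤ 1) → (θ.expect h - θ'.expect h) / 2 ≤ c) :
    dTV θ θ' ≤ c := by
  refine csSup_le ⟨_, fun _ _ => 0, by simp, rfl⟩ ?_
  rintro _ ⟨h, hh, rfl⟩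
  exact hc h hh

/-- Summing the variation of the split weights over both states gives `2 |m - m'| / gap`. -/
theorem sum_abs_splitWeight_mul {a : Bool → ℝ} {m m' : ℝ} (ha : a false < a true)
    (ha0 : ∀ s, 0 ≤ a s) (ha1 : ∀ s, a s ≤ 1) :
    ∑ s, |splitWeight a m s * a s - splitWeight a m' s * a s| +
      ∑ s, |splitWeight a m s * (1 - a s) - splitWeight a m' s * (1 - a s)| =
      2 * (|m - m'| / (a true - a false)) := by
  have h (s) : 0 ≤ 1 - a s := sub_nonneg.2 (ha1 s)
  simp only [← sub_mul, abs_mul, abs_splitWeight_sub ha, abs_of_nonneg (ha0 _),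
    abs_of_nonneg (h _), Fintype.sum_bool]
  ring

/-- Moving the prior from `m` to `m'` with both report pairs fixed. -/
theorem sum_splitWeight_sub_le {a b : Bool → ℝ} {m m' : ℝ}
    (ha0 : ∀ s, 0 ≤ a s) (ha1 : ∀ s, a s ≤ 1) (hb0 : ∀ s, 0 ≤ b s) (hb1 : ∀ s, b s ≤ 1)
    (ha : a false < a true) (hb : b false < b true) (hm0 : 0 < m) (hm1 : m < 1)
    (ham : a false ≤ m) (hma : m ≤ a true) (hbm : b false ≤ m) (hmb : m ≤ b true)
    (ham' : a false ≤ m') (hma' : m' ≤ a true)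
    {h : ℝ → ℝ → ℝ} (hh : ∀ x y, |h x y| ≤ 1) :
    ∑ s, ∑ t, splitWeight a m' s * splitWeight b m' t *
        (reportDensity m' (a s) (b t) * h (a s) (b t)) -
      ∑ s, ∑ t, splitWeight a m s * splitWeight b m t *
        (reportDensity m (a s) (b t) * h (a s) (b t)) ≤
      2 * (|m - m'| / (a true - a false)) + 2 * (|m - m'| / (b true - b false)) +
        2 * |m - m'| := by
  have sa (n : ℝ) : ∑ s, splitWeight a n s * (1 - a s) = 1 - n := by
    simp only [mul_sub, mul_one, Finset.sum_sub_distrib, sum_splitWeight ha,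
      sum_splitWeight_mul ha]
  have sb (n : ℝ) : ∑ s, splitWeight b n s * (1 - b s) = 1 - n := by
    simp only [mul_sub, mul_one, Finset.sum_sub_distrib, sum_splitWeight hb,
      sum_splitWeight_mul hb]
  have wa := splitWeight_nonneg ham hma
  have wb := splitWeight_nonneg hbm hmb
  have wa' := splitWeight_nonneg ham' hma'
  have T := sum_abs_mul_div_sub_le (r' := fun t => splitWeight b m' t * b t)
    (fun s => mul_nonneg (wa s) (ha0 s)) (fun t => mul_nonneg (wb t) (hb0 t))
    (fun s => mul_nonneg (wa' s) (ha0 s))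
    (sum_splitWeight_mul ha) (sum_splitWeight_mul hb) (sum_splitWeight_mul ha) hm0
    ((ha0 false).trans ham')
  have F := sum_abs_mul_div_sub_le (r' := fun t => splitWeight b m' t * (1 - b t))
    (fun s => mul_nonneg (wa s) (sub_nonneg.2 (ha1 s)))
    (fun t => mul_nonneg (wb t) (sub_nonneg.2 (hb1 t)))
    (fun s => mul_nonneg (wa' s) (sub_nonneg.2 (ha1 s)))
    (sa m) (sb m) (sa m') (sub_pos.2 hm1) (sub_nonneg.2 (hma'.trans (ha1 true)))
  have A := sum_abs_splitWeight_mul (m := m) (m' := m') ha ha0 ha1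
  have B := sum_abs_splitWeight_mul (m := m) (m' := m') hb hb0 hb1
  have E : |(1 - m) - (1 - m')| = |m - m'| := by
    rw [abs_sub_comm m m']
    congr 1
    ring
  rw [E] at F
  refine le_trans ?_ (by linarith [T, F, A, B] :
    (∑ s, ∑ t, |splitWeight a m s * a s * (splitWeight b m t * b t) / m -
      splitWeight a m' s * a s * (splitWeight b m' t * b t) / m'|) +
    (∑ s, ∑ t, |splitWeight a m s * (1 - a s) * (splitWeight b m t * (1 - b t)) / (1 - m) -
      splitWeight a m' s * (1 - a s) * (splitWeight b m' t * (1 - b t)) / (1 - m')|) ≤ _)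
  simp only [← Finset.sum_sub_distrib, ← Finset.sum_add_distrib]
  refine Finset.sum_le_sum fun s _ => Finset.sum_le_sum fun t _ => ?_
  set x := splitWeight a m s * a s * (splitWeight b m t * b t) / m -
    splitWeight a m' s * a s * (splitWeight b m' t * b t) / m' with hx
  set y := splitWeight a m s * (1 - a s) * (splitWeight b m t * (1 - b t)) / (1 - m) -
    splitWeight a m' s * (1 - a s) * (splitWeight b m' t * (1 - b t)) / (1 - m') with hy
  have e : splitWeight a m' s * splitWeight b m' t *
        (reportDensity m' (a s) (b t) * h (a s) (b t)) -
      splitWeight a m s * splitWeight b m t *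
        (reportDensity m (a s) (b t) * h (a s) (b t)) = -(x + y) * h (a s) (b t) := by
    rw [hx, hy, reportDensity, reportDensity]
    ring
  rw [e]
  calc -(x + y) * h (a s) (b t) ≤ |-(x + y) * h (a s) (b t)| := le_abs_self _
    _ = |x + y| * |h (a s) (b t)| := by rw [abs_mul, abs_neg]
    _ ≤ |x + y| * 1 := by gcongr; exact hh _ _
    _ ≤ |x| + |y| := by rw [mul_one]; exact abs_add_le x y

/-- `Θ̄_{N,M}` is a `(6N/M, d_TV)`-covering of `Θ̄_N`: for all `N, M ∈ ℕ`
with `M > N ≥ 1`, every binary-signal conditionally independent information structure whose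
reports lie in the grid `[1/N]` is within total variation distance `6N/M` (of report
distributions) of one whose reports lie in `[1/N]` and whose prior lies in `[1/M]`. -/
theorem dTV_covering (N M : ℕ) (hN : 1 ≤ N) (hNM : N < M)
    (θ' : InfoStruct Bool Bool) (hθ' : reportsInGrid N θ') :
    ∃ θ : InfoStruct Bool Bool, reportsInGrid N θ ∧ inGrid M θ.prior ∧
      dTV θ θ' ≤ 6 * (N : ℝ) / (M : ℝ) := by
  have hN0 : (0 : ℝ) < N := by exact_mod_cast hN
  have hM : 0 < M := by omega
  have hM0 : (0 : ℝ) < M := by exact_mod_cast hM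
  have hNM' : (N : ℝ) ≤ M := by exact_mod_cast hNM.le
  have self (hg : inGrid M θ'.prior) : ∃ θ : InfoStruct Bool Bool, reportsInGrid N θ ∧
      inGrid M θ.prior ∧ dTV θ θ' ≤ 6 * (N : ℝ) / (M : ℝ) := by
    refine ⟨θ', hθ', hg, dTV_le fun h _ => ?_⟩
    rw [sub_self, zero_div]
    positivity
  rcases θ'.prior_nonneg.eq_or_lt with h0 | h0
  · exact self ⟨0, by omega, by simp [← h0]⟩
  rcases θ'.prior_le_one.eq_or_lt with h1 | h1
  · exact self ⟨M, le_rfl, by rw [h1, div_self hM0.ne']⟩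
  obtain ⟨a, hag, ham, hma, hfa⟩ :=
    exists_splitWeight hN θ'.p1_nonneg θ'.sum_p1 θ'.sum_p1_mul_x1 hθ'.1 h1
  obtain ⟨b, hbg, hbm, hmb, hfb⟩ :=
    exists_splitWeight hN θ'.p2_nonneg θ'.sum_p2 θ'.sum_p2_mul_x2 hθ'.2 h1
  have hexp (h : ℝ → ℝ → ℝ) : θ'.expect h =
      ∑ s, ∑ t, splitWeight a θ'.prior s * splitWeight b θ'.prior t *
        (reportDensity θ'.prior (a s) (b t) * h (a s) (b t)) := by
    rw [expect_eq θ' h0 h1]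
    simp only [mul_assoc, ← Finset.mul_sum]
    rw [← hfa fun x => ∑ t, splitWeight b θ'.prior t *
      (reportDensity θ'.prior x (b t) * h x (b t))]
    exact Finset.sum_congr rfl fun s _ => congrArg _
      (hfb fun y => reportDensity θ'.prior (θ'.x1 s) y * h (θ'.x1 s) y)
  generalize θ'.prior = m at *
  have hab : a false < a true := ham.trans_lt hma
  have hbb : b false < b true := hbm.trans_lt hmb
  have gap {x y : ℝ} (hx : inGrid N x) (hy : inGrid N y) (hxy : x < y) : 1 ≤ M * (y - x) :=
    (hx.one_le_mul_sub hN hy hxy).trans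
      (mul_le_mul_of_nonneg_right hNM' (sub_pos.2 hxy).le)
  obtain ⟨m', hg, hL, hU, hd⟩ :=
    exists_inGrid_near hM (L := max (a false) (b false)) (U := min (a true) (b true))
      (le_max_of_le_left (hag _).nonneg) (min_le_of_left_le (hag _).le_one)
      (max_le ham hbm) (le_min hma.le hmb.le)
      (gap (by rcases max_choice (a false) (b false) with h | h <;> rw [h] <;> simp [hag, hbg])
        (by rcases min_choice (a true) (b true) with h | h <;> rw [h] <;> simp [hag, hbg])
        ((max_le ham hbm).trans_lt (lt_min hma hmb)))
  obtain ⟨ham', hbm'⟩ := max_le_iff.1 hL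
  obtain ⟨hma', hmb'⟩ := le_min_iff.1 hU
  have report {w x : ℝ} (hx : inGrid N x) : inGrid N (w * x / w) := by
    rcases eq_or_ne w 0 with h | h
    · exact ⟨0, by omega, by simp [h]⟩
    · rwa [mul_div_cancel_left₀ _ h]
  refine ⟨ofReports (splitWeight a m') a (splitWeight b m') b m'
    (splitWeight_nonneg ham' hma') (fun s => (hag s).nonneg) (fun s => (hag s).le_one)
    (splitWeight_nonneg hbm' hmb') (fun s => (hbg s).nonneg) (fun s => (hbg s).le_one)
    (sum_splitWeight hab) (sum_splitWeight hbb) (sum_splitWeight_mul hab)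
    (sum_splitWeight_mul hbb) hg.nonneg hg.le_one,
    ⟨fun s => ?_, fun s => ?_⟩, ?_, dTV_le fun h hh => ?_⟩
  · rw [ofReports_x1]
    exact report (hag s)
  · rw [ofReports_x2]
    exact report (hbg s)
  · rwa [ofReports_prior]
  · rw [hexp, ofReports_expect]
    have key := sum_splitWeight_sub_le (fun s => (hag s).nonneg) (fun s => (hag s).le_one)
      (fun s => (hbg s).nonneg) (fun s => (hbg s).le_one) hab hbb h0 h1 ham hma.le hbm hmb.le
      ham' hma' hh
    have quot {x y : ℝ} (hx : inGrid N x) (hy : inGrid N y) (hxy : x < y) :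
        |m - m'| / (y - x) ≤ N / M := by
      have h1 := hx.one_le_mul_sub hN hy hxy
      have hpos := sub_pos.2 hxy
      rw [div_le_iff₀ hpos]
      refine hd.trans ?_
      rw [div_mul_eq_mul_div]
      gcongr
    have qa := quot (hag false) (hag true) hab
    have qb := quot (hbg false) (hbg true) hbb
    have q1 : (1 : ℝ) / M ≤ N / M := by
      gcongr
      exact_mod_cast hN
    have : 0 ≤ (N : ℝ) / M := by positivity
    rw [mul_div_assoc]
    linarith
end

section
/- Let Θ be a finite set with |Θ| = n ≥ 2, F a convex subset of a real vector space, R : F × Θ → [0,1] convex in its first argument, ε > 0, and T ∈ ℕ with T ≥ 1. Suppose probability vectors w¹, …, w^T ∈ Δ_Θ and elements f¹, …, f^T ∈ F satisfy: (i) each f^t is an ε/5-best response to w^t, i.e. E_{θ∼w^t}[R(f^t, θ)] ≤ E_{θ∼w^t}[R(f, θ)] + ε/5 for every f ∈ F; and (ii) the online-learning regret bound max_{θ∈Θ} Σ_{t=1}^T R(f^t, θ) − Σ_{t=1}^T Σ_{θ∈Θ} w^t_θ·R(f^t, θ) ≤ √(2T·ln n) + ln n holds. Then, setting f̄ = (1/T)·Σ_{t=1}^T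 f^t, w̄ = (1/T)·Σ_{t=1}^T w^t, and δ = (√(2T·ln n) + ln n)/T + ε/5, the pair (f̄, w̄) is a δ-equilibrium: max_{θ∈Θ} R(f̄, θ) − δ ≤ E_{θ∼w̄}[R(f̄, θ)] ≤ inf_{f∈F} E_{θ∼w̄}[R(f, θ)] + δ. -/
open Finset

/-- Online learning yields an approximate equilibrium: if each `f^t` is an
`ε/5`-best response to `w^t` and the online-learning regret bound
`max_θ Σ_t R(f^t,θ) - Σ_t Σ_θ w^t_θ·R(f^t,θ) ≤ √(2T·ln n) + ln n` holds, then, with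
`f̄ = (1/T)Σ_t f^t`, `w̄ = (1/T)Σ_t w^t` and `δ = (√(2T·ln n) + ln n)/T + ε/5`, the pair
`(f̄, w̄)` is a `δ`-equilibrium of the zero-sum game with payoff `R`. -/
theorem online_learning_equilibrium {V : Type*} [AddCommGroup V] [Module ℝ V]
    {Θ : Type*} [Fintype Θ] (n : ℕ) (hcard : Fintype.card Θ = n) (hn : 2 ≤ n)
    (F : Set V) (hF : Convex ℝ F)
    (R : V → Θ → ℝ)
    (hR01 : ∀ f ∈ F, ∀ θ : Θ, R f θ ∈ Set.Icc (0 : ℝ) 1)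
    (hRconv : ∀ θ : Θ, ∀ f ∈ F, ∀ f' ∈ F, ∀ t ∈ Set.Icc (0 : ℝ) 1,
      R (t • f + (1 - t) • f') θ ≤ t * R f θ + (1 - t) * R f' θ)
    (ε : ℝ) (hε : 0 < ε) (T : ℕ) (hT : 1 ≤ T)
    (w : Fin T → Θ → ℝ) (hw0 : ∀ t θ, 0 ≤ w t θ) (hw1 : ∀ t, ∑ θ : Θ, w t θ = 1)
    (fs : Fin T → V) (hfsF : ∀ t, fs t ∈ F)
    (hbest : ∀ t : Fin T, ∀ f ∈ F,
      ∑ θ : Θ, w t θ * R (fs t) θ ≤ (∑ θ : Θ, w t θ * R f θ) + ε / 5)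
    (hregret : ∀ θ : Θ,
      (∑ t : Fin T, R (fs t) θ) - (∑ t : Fin T, ∑ θ' : Θ, w t θ' * R (fs t) θ') ≤
        Real.sqrt (2 * (T : ℝ) * Real.log (n : ℝ)) + Real.log (n : ℝ)) :
    let fbar : V := (T : ℝ)⁻¹ • ∑ t : Fin T, fs t
    let wbar : Θ → ℝ := fun θ => (T : ℝ)⁻¹ * ∑ t : Fin T, w t θ
    let δ : ℝ := (Real.sqrt (2 * (T : ℝ) * Real.log (n : ℝ)) + Real.log (n : ℝ)) / (T : ℝ)
      + ε / 5
    (∀ θ : Θ, R fbar θ - δ ≤ ∑ θ' : Θ, wbar θ' * R fbar θ') ∧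
      ∀ f ∈ F, (∑ θ' : Θ, wbar θ' * R fbar θ') ≤ (∑ θ' : Θ, wbar θ' * R f θ') + δ := by
  intro fbar wbar δ
  have hT0 : (0 : ℝ) < T := by exact_mod_cast hT
  have hTT : (T : ℝ)⁻¹ * T = 1 := inv_mul_cancel₀ hT0.ne'
  have hinv : (0 : ℝ) ≤ (T : ℝ)⁻¹ := (inv_pos.2 hT0).le
  have hsum : ∑ _t : Fin T, (T : ℝ)⁻¹ = 1 := by simp [hT0.ne']
  have hfbar : fbar = ∑ t : Fin T, (T : ℝ)⁻¹ • fs t := Finset.smul_sum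
  have hfbarF : fbar ∈ F :=
    hfbar ▸ hF.sum_mem (fun _ _ => hinv) hsum (fun t _ => hfsF t)
  have hjensen : ∀ θ, R fbar θ ≤ (T : ℝ)⁻¹ * ∑ t, R (fs t) θ := by
    intro θ
    have hconv : ConvexOn ℝ F (fun f => R f θ) := by
      refine ⟨hF, fun x hx y hy a b ha hb hab => ?_⟩
      obtain rfl : b = 1 - a := by linarith
      exact hRconv θ x hx y hy a ⟨ha, by linarith⟩
    have h := hconv.map_sum_le (t := Finset.univ) (w := fun _ : Fin T => (T : ℝ)⁻¹) (p := fs)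
      (fun _ _ => hinv) hsum (fun t _ => hfsF t)
    rw [hfbar, Finset.mul_sum]
    exact h
  have havg : ∀ f, ∑ θ, wbar θ * R f θ = (T : ℝ)⁻¹ * ∑ t, ∑ θ, w t θ * R f θ := by
    intro f
    simp only [wbar, mul_assoc, ← Finset.mul_sum, Finset.sum_mul]
    rw [Finset.sum_comm]
  have hwbar0 : ∀ θ, 0 ≤ wbar θ := fun θ =>
    mul_nonneg hinv (Finset.sum_nonneg fun t _ => hw0 t θ)
  have hwbar1 : ∑ θ, wbar θ = 1 := by
    simp only [wbar, ← Finset.mul_sum]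
    rw [Finset.sum_comm]
    simp [hw1, hT0.ne']
  have hkey : ∀ f ∈ F, ∀ θ, R fbar θ ≤ (∑ θ', wbar θ' * R f θ') + δ := by
    intro f hf θ
    have hb : ∑ t, ∑ θ', w t θ' * R (fs t) θ' ≤
        (∑ t, ∑ θ', w t θ' * R f θ') + T * (ε / 5) := by
      calc _ ≤ ∑ t, ((∑ θ', w t θ' * R f θ') + ε / 5) :=
            Finset.sum_le_sum fun t _ => hbest t f hf
        _ = _ := by simp [Finset.sum_add_distrib]
    have hr := hregret θ
    calc R fbar θ ≤ (T : ℝ)⁻¹ * ∑ t, R (fs t) θ := hjensen θ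
      _ ≤ (T : ℝ)⁻¹ * ((∑ t, ∑ θ', w t θ' * R f θ') + T * (ε / 5) +
            (Real.sqrt (2 * (T : ℝ) * Real.log (n : ℝ)) + Real.log (n : ℝ))) :=
          mul_le_mul_of_nonneg_left (by linarith) hinv
      _ = (∑ θ', wbar θ' * R f θ') + δ := by
          rw [havg f]
          simp only [δ, div_eq_mul_inv _ (T : ℝ)]
          linear_combination (ε / 5) * hTT
  refine ⟨fun θ => by linarith [hkey fbar hfbarF θ], fun f hf => ?_⟩
  calc ∑ θ', wbar θ' * R fbar θ'
      ≤ ∑ θ', wbar θ' * ((∑ θ', wbar θ' * R f θ') + δ) :=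
        Finset.sum_le_sum fun θ _ => mul_le_mul_of_nonneg_left (hkey f hf θ) (hwbar0 θ)
    _ = (∑ θ', wbar θ' * R f θ') + δ := by rw [← Finset.sum_mul, hwbar1, one_mul]
end
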